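/- Let Ω ⊆ ℝ³ be an open set, let k be a nonzero real number, let c : Ω → ℂ, and let u, u₀, v : Ω → ℂ be twice continuously differentiable with u and u₀ nowhere vanishing on Ω. Assume: (i) Δu(x) + k² c(x) u(x) = 0 for all x ∈ Ω; (ii) Δu₀(x) + k² u₀(x) = 0 for all x ∈ Ω; (iii) ∂ᵢv(x) = (1/k²)(∂ᵢu(x)/u(x) − ∂ᵢu₀(x)/u₀(x)) for i = 1, 2, 3 and all x ∈ Ω. Then for all x ∈ Ω, Δv(x) + k² Σᵢ (∂ᵢv(x))² + (2/u₀(x)) Σᵢ ∂ᵢv(x) ∂ᵢu₀(x) = 1 − c(x), where Δw = Σᵢ ∂²w/∂xᵢ² and the sums run over i = 1, 2, 3. -/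

import Mathlib

open scoped BigOperators

/-- Partial derivative of a complex-valued function on `ℝ³` in the `i`-th coordinate
direction. -/
noncomputable def pderiv3 (i : Fin 3) (w : EuclideanSpace ℝ (Fin 3) → ℂ)
    (x : EuclideanSpace ℝ (Fin 3)) : ℂ :=
  fderiv ℝ w x (EuclideanSpace.single i (1 : ℝ))

/-- The Laplacian of a complex-valued function on `ℝ³`: `Δw = Σᵢ ∂²w/∂xᵢ²`. -/
noncomputable def laplacian3 (w : EuclideanSpace ℝ (Fin 3) → ℂ)
    (x : EuclideanSpace ℝ (Fin 3)) : ℂ :=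
  ∑ i : Fin 3, pderiv3 i (pderiv3 i w) x

/-- A partial derivative of a `C²` function on an open subset of `ℝ³` is differentiable there. -/
theorem differentiableAt_pderiv3 {Ω : Set (EuclideanSpace ℝ (Fin 3))} (hΩ : IsOpen Ω)
    {w : EuclideanSpace ℝ (Fin 3) → ℂ} (hw : ContDiffOn ℝ 2 w Ω) (i : Fin 3)
    {x : EuclideanSpace ℝ (Fin 3)} (hx : x ∈ Ω) : DifferentiableAt ℝ (pderiv3 i w) x := by
  have h : ContDiffAt ℝ 1 (fderiv ℝ w) x :=
    (hw.contDiffAt (hΩ.mem_nhds hx)).fderiv_right (by norm_num)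
  exact (h.differentiableAt (by norm_num)).clm_apply (differentiableAt_const _)

/-- The quotient rule for partial derivatives. -/
theorem pderiv3_div (i : Fin 3) {f g : EuclideanSpace ℝ (Fin 3) → ℂ}
    {x : EuclideanSpace ℝ (Fin 3)} (hf : DifferentiableAt ℝ f x) (hg : DifferentiableAt ℝ g x)
    (hne : g x ≠ 0) :
    pderiv3 i (fun y => f y / g y) x
      = (pderiv3 i f x * g x - f x * pderiv3 i g x) / g x ^ 2 := by
  have hinv : HasFDerivAt (fun y => (g y)⁻¹) _ x :=
    (hasFDerivAt_inv' (𝕜 := ℝ) hne).comp x hg.hasFDerivAt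
  simp only [pderiv3, div_eq_mul_inv]
  rw [(hf.hasFDerivAt.fun_mul hinv).fderiv]
  simp
  field_simp
  ring

/-- The second partial derivative of `a (log f - log g)`, expressed through a function whose
gradient is that of `a (log f - log g)`. -/
theorem pderiv3_pderiv3_of_log_gradient {Ω : Set (EuclideanSpace ℝ (Fin 3))} (hΩ : IsOpen Ω)
    {f g w : EuclideanSpace ℝ (Fin 3) → ℂ} (a : ℂ)
    (hf : ContDiffOn ℝ 2 f Ω) (hg : ContDiffOn ℝ 2 g Ω)
    (hf_ne : ∀ x ∈ Ω, f x ≠ 0) (hg_ne : ∀ x ∈ Ω, g x ≠ 0) (i : Fin 3)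
    (hgrad : ∀ x ∈ Ω, pderiv3 i w x = a * (pderiv3 i f x / f x - pderiv3 i g x / g x))
    {x : EuclideanSpace ℝ (Fin 3)} (hx : x ∈ Ω) :
    pderiv3 i (pderiv3 i w) x
      = a * ((pderiv3 i (pderiv3 i f) x * f x - pderiv3 i f x * pderiv3 i f x) / f x ^ 2
        - (pderiv3 i (pderiv3 i g) x * g x - pderiv3 i g x * pderiv3 i g x) / g x ^ 2) := by
  have hfx : DifferentiableAt ℝ f x :=
    (hf.contDiffAt (hΩ.mem_nhds hx)).differentiableAt (by norm_num)
  have hgx : DifferentiableAt ℝ g x :=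
    (hg.contDiffAt (hΩ.mem_nhds hx)).differentiableAt (by norm_num)
  have hf' := differentiableAt_pderiv3 hΩ hf i hx
  have hg' := differentiableAt_pderiv3 hΩ hg i hx
  have heq : pderiv3 i w =ᶠ[nhds x]
      fun y => a * (pderiv3 i f y / f y - pderiv3 i g y / g y) :=
    Filter.eventually_of_mem (hΩ.mem_nhds hx) hgrad
  have hdf : DifferentiableAt ℝ (fun y => pderiv3 i f y / f y) x := by
    simpa only [div_eq_mul_inv] using hf'.fun_mul (hfx.fun_inv (hf_ne x hx))
  have hdg : DifferentiableAt ℝ (fun y => pderiv3 i g y / g y) x := by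
    simpa only [div_eq_mul_inv] using hg'.fun_mul (hgx.fun_inv (hg_ne x hx))
  rw [← pderiv3_div i hf' hfx (hf_ne x hx), ← pderiv3_div i hg' hgx (hg_ne x hx),
    pderiv3, heq.fderiv_eq, fderiv_const_mul (hdf.fun_sub hdg), fderiv_fun_sub hdf hdg]
  rfl

/-- If `u` solves the Helmholtz equation `Δu + k²cu = 0`, `u₀` solves `Δu₀ + k²u₀ = 0`,
and `∇v = (1/k²)(∇u/u − ∇u₀/u₀)` on an open set `Ω ⊆ ℝ³` (with `u`, `u₀` nowhere vanishing
and `u`, `u₀`, `v` twice continuously differentiable), then `v` satisfies the quasi-linear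
equation `Δv + k²Σᵢ(∂ᵢv)² + (2/u₀)Σᵢ ∂ᵢv ∂ᵢu₀ = 1 − c` on `Ω`. -/
theorem quasilinear_equation_for_v
    (Ω : Set (EuclideanSpace ℝ (Fin 3))) (hΩ : IsOpen Ω)
    (k : ℝ) (hk : k ≠ 0)
    (c u u₀ v : EuclideanSpace ℝ (Fin 3) → ℂ)
    (hu : ContDiffOn ℝ 2 u Ω) (hu₀ : ContDiffOn ℝ 2 u₀ Ω) (hv : ContDiffOn ℝ 2 v Ω)
    (hu_ne : ∀ x ∈ Ω, u x ≠ 0) (hu₀_ne : ∀ x ∈ Ω, u₀ x ≠ 0)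
    (hHelmholtz : ∀ x ∈ Ω, laplacian3 u x + (k : ℂ) ^ 2 * c x * u x = 0)
    (hHelmholtz₀ : ∀ x ∈ Ω, laplacian3 u₀ x + (k : ℂ) ^ 2 * u₀ x = 0)
    (hgrad : ∀ x ∈ Ω, ∀ i : Fin 3,
      pderiv3 i v x = (1 / (k : ℂ) ^ 2) * (pderiv3 i u x / u x - pderiv3 i u₀ x / u₀ x)) :
    ∀ x ∈ Ω,
      laplacian3 v x + (k : ℂ) ^ 2 * ∑ i : Fin 3, (pderiv3 i v x) ^ 2
        + (2 / u₀ x) * ∑ i : Fin 3, pderiv3 i v x * pderiv3 i u₀ x = 1 - c x := by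
  intro x hx
  have hk' : (k : ℂ) ≠ 0 := Complex.ofReal_ne_zero.mpr hk
  have hux := hu_ne x hx
  have hu₀x := hu₀_ne x hx
  have hH := hHelmholtz x hx
  have hH₀ := hHelmholtz₀ x hx
  have hterm (i : Fin 3) : pderiv3 i (pderiv3 i v) x + (k : ℂ) ^ 2 * pderiv3 i v x ^ 2
      + 2 / u₀ x * (pderiv3 i v x * pderiv3 i u₀ x)
      = 1 / (k : ℂ) ^ 2 * (pderiv3 i (pderiv3 i u) x / u x
        - pderiv3 i (pderiv3 i u₀) x / u₀ x) := by
    rw [pderiv3_pderiv3_of_log_gradient hΩ _ hu hu₀ hu_ne hu₀_ne i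
      (fun y hy => hgrad y hy i) hx, hgrad x hx i]
    field_simp
    ring
  calc
    _ = 1 / (k : ℂ) ^ 2 * (laplacian3 u x / u x - laplacian3 u₀ x / u₀ x) := by
      simp only [laplacian3, Finset.mul_sum, Finset.sum_div, ← Finset.sum_add_distrib,
        ← Finset.sum_sub_distrib, hterm]
    _ = 1 - c x := by
      rw [eq_neg_of_add_eq_zero_left hH, eq_neg_of_add_eq_zero_left hH₀]
      field_simp
      ring
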